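/- The group G contains no element of order 16. -/

import Mathlib

/-- The group `G = ⟨α, β ∣ α⁴⁰ = β⁴ = 1, βαβ⁻¹ = α¹³⟩` of order 160
contains no element of order 16. -/
theorem no_element_of_order_sixteen
    (G : Type*) [Group G] (α β : G)
    (hgen : Subgroup.closure {α, β} = ⊤)
    (hα : α ^ 40 = 1) (hβ : β ^ 4 = 1)
    (hrel : β * α * β⁻¹ = α ^ 13)
    (hcard : Nat.card G = 160) :
    ∀ g : G, orderOf g ≠ 16 := by
  have h1 : ∀ k : ℕ, β * α ^ k = α ^ (13 * k) * β := by
    intro k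
    rw [pow_mul, ← hrel, conj_pow]
    group
  have h2 : ∀ j k : ℕ, β ^ j * α ^ k = α ^ (13 ^ j * k) * β ^ j := by
    intro j
    induction j with
    | zero => intro k; simp
    | succ j ih =>
      intro k
      rw [pow_succ β, mul_assoc, h1, ← mul_assoc, ih, mul_assoc]
      congr 2
      ring
  have hmul : ∀ i j k l : ℕ, (α ^ i * β ^ j) * (α ^ k * β ^ l)
      = α ^ (i + 13 ^ j * k) * β ^ (j + l) := by
    intro i j k l
    rw [mul_assoc, ← mul_assoc (β ^ j), h2, pow_add, pow_add]
    simp only [mul_assoc]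
  have hform : ∀ g : G, ∃ i j : ℕ, g = α ^ i * β ^ j := by
    intro g
    have hg : g ∈ Subgroup.closure {α, β} := hgen ▸ Subgroup.mem_top g
    induction hg using Subgroup.closure_induction with
    | mem x hx =>
      rcases hx with rfl | rfl
      · exact ⟨1, 0, by simp⟩
      · exact ⟨0, 1, by simp⟩
    | one => exact ⟨0, 0, by simp⟩
    | mul x y _ _ hx hy =>
      obtain ⟨i, j, rfl⟩ := hx
      obtain ⟨k, l, rfl⟩ := hy
      exact ⟨_, _, hmul i j k l⟩
    | inv x _ hx =>
      obtain ⟨i, j, rfl⟩ := hx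
      refine ⟨13 ^ (3 * j) * (39 * i), 3 * j, ?_⟩
      rw [← h2, mul_inv_rev]
      congr 1
      · rw [inv_eq_iff_mul_eq_one, ← pow_add, show j + 3 * j = 4 * j by ring, pow_mul, hβ, one_pow]
      · rw [inv_eq_iff_mul_eq_one, ← pow_add, show i + 39 * i = 40 * i by ring, pow_mul, hα,
          one_pow]
  intro g hg
  obtain ⟨i, j, rfl⟩ := hform g
  have h4 : (α ^ i * β ^ j) ^ 4 = α ^ (i * ((1 + 13 ^ j) * (1 + (13 ^ j) ^ 2))) := by
    rw [show (4 : ℕ) = 2 * 2 by rfl, pow_mul, pow_two (α ^ i * β ^ j), hmul, pow_two, hmul,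
      show j + j + (j + j) = 4 * j by ring, pow_mul β, hβ, one_pow, mul_one]
    congr 1
    ring
  have hodd : Odd (13 ^ j) := Odd.pow (by decide)
  obtain ⟨m, hm⟩ := hodd
  have h40 : (α ^ i * β ^ j) ^ 40 = 1 := by
    rw [show (40 : ℕ) = 4 * 10 by rfl, pow_mul, h4, ← pow_mul, hm,
      show i * ((1 + (2 * m + 1)) * (1 + (2 * m + 1) ^ 2)) * 10
        = 40 * (i * ((1 + m) * (1 + 2 * m + 2 * m ^ 2))) by ring, pow_mul, hα, one_pow]
  have := orderOf_dvd_of_pow_eq_one h40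
  rw [hg] at this
  omega
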